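/- Let μ be a complex number and n ≥ 1 an integer. Then (μ+3) · b_{2n}(1,1,μ) = −4 · b_{2n−1}(2,2,μ); that is, the ratio b_{2n}(1,1,μ)/b_{2n−1}(2,2,μ) is independent of n and equals −4/(μ+3) whenever the denominator is nonzero. -/

import Mathlib

/-- Generalized binomial coefficient `C(x,k) = x(x-1)⋯(x-k+1)/k!` for complex `x`. -/
noncomputable def gbinom (x : ℂ) (k : ℕ) : ℂ :=
  (∏ i ∈ Finset.range k, (x - i)) / (k.factorial : ℂ)

/-- Pochhammer symbol `(x)_k = x(x+1)⋯(x+k-1)`. -/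
noncomputable def poch (x : ℂ) (k : ℕ) : ℂ :=
  ∏ i ∈ Finset.range k, (x + i)
/-- `b_n(I,J,μ)`: determinant of the `n×n` matrix with rows indexed by
`i = I,…,n-1+I`, columns indexed by `j = J,…,n-1+J`, and entries
`-δ_{i,j} + C(μ+i+j-2, j)`. -/
noncomputable def bdet (μ : ℂ) (n I J : ℕ) : ℂ :=
  Matrix.det (Matrix.of fun i j : Fin n =>
    (if I + i.1 = J + j.1 then (-1 : ℂ) else 0)
      + gbinom (μ + ((I + i.1 : ℕ) : ℂ) + ((J + j.1 : ℕ) : ℂ) - 2) (J + j.1))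

open Polynomial Finset

theorem gbinom_eq_choose (x : ℂ) (k : ℕ) : gbinom x k = Ring.choose x k := by
  rw [Ring.choose_eq_smul, gbinom, smul_eq_mul, div_eq_inv_mul, ← aeval_eq_smeval,
    ← eval_map_algebraMap, descPochhammer_map, descPochhammer_eval_eq_prod_range]

theorem choose_add_eq_sum_range (r s : ℂ) (m : ℕ) :
    Ring.choose (r + s) m = ∑ k ∈ range (m + 1), Ring.choose r (m - k) * Ring.choose s k := by
  rw [add_comm r s, Ring.add_choose_eq m (Commute.all s r),
    Nat.sum_antidiagonal_eq_sum_range_succ (fun i j => Ring.choose s i * Ring.choose r j)]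
  exact sum_congr rfl fun k _ => mul_comm _ _

theorem choose_neg_eq (x : ℂ) (k : ℕ) :
    Ring.choose (-x) k = (-1) ^ k * Ring.choose (x + k - 1) k := by
  rw [Ring.choose_neg, Int.negOnePow_def, Units.smul_def]
  simp

/-- On coefficient sequences, the substitution `f(t) ↦ (1 - t)^(1 - μ) f(t / (t - 1))`. -/
noncomputable def binomTwist (μ : ℂ) : (ℕ → ℂ) →ₗ[ℂ] (ℕ → ℂ) where
  toFun p m := ∑ k ∈ range (m + 1), (-1) ^ k * Ring.choose (μ + m - 2) (m - k) * p k
  map_add' p q := by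
    ext m
    simp [mul_add, sum_add_distrib]
  map_smul' c p := by
    ext m
    simp only [Pi.smul_apply, smul_eq_mul, mul_sum, RingHom.id_apply]
    exact sum_congr rfl fun k _ => by ring

theorem binomTwist_apply (μ : ℂ) (p : ℕ → ℂ) (m : ℕ) :
    binomTwist μ p m =
      ∑ k ∈ range (m + 1), (-1) ^ k * Ring.choose (μ + m - 2) (m - k) * p k := rfl

theorem sum_twist_coeff_mul (μ : ℂ) (l d : ℕ) :
    ∑ j ∈ range (d + 1), (-1) ^ (l + j) * Ring.choose (μ + (l + d : ℕ) - 2) (d - j) *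
      ((-1) ^ l * Ring.choose (μ + (l + j : ℕ) - 2) j) = if d = 0 then 1 else 0 := by
  have h : ∀ j ∈ range (d + 1), (-1) ^ (l + j) * Ring.choose (μ + (l + d : ℕ) - 2) (d - j) *
      ((-1) ^ l * Ring.choose (μ + (l + j : ℕ) - 2) j) =
      Ring.choose (μ + (l + d : ℕ) - 2) (d - j) * Ring.choose (-(μ + l - 1)) j := by
    intro j _
    have hl : ((-1 : ℂ) ^ l) * (-1) ^ l = 1 := by rw [← mul_pow]; simp
    rw [choose_neg_eq, pow_add,
      show μ + (l + j : ℕ) - 2 = μ + l - 1 + j - 1 by push_cast; ring]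
    linear_combination (-1) ^ j * Ring.choose (μ + (l + d : ℕ) - 2) (d - j) *
      Ring.choose (μ + l - 1 + j - 1) j * hl
  rw [sum_congr rfl h, ← choose_add_eq_sum_range]
  rcases d with _ | d
  · simp
  · rw [show μ + (l + (d + 1) : ℕ) - 2 + -(μ + l - 1) = (d : ℂ) by push_cast; ring,
      Ring.choose_natCast]
    simp

theorem binomTwist_binomTwist (μ : ℂ) (p : ℕ → ℂ) : binomTwist μ (binomTwist μ p) = p := by
  ext m
  simp only [binomTwist_apply, mul_sum]
  rw [Finset.sum_comm' (t' := range (m + 1)) (s' := fun l => Ico l (m + 1))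
    (by intro x y; simp only [mem_range, mem_Ico]; omega)]
  have h : ∀ l ∈ range (m + 1), ∑ k ∈ Ico l (m + 1),
      (-1) ^ k * Ring.choose (μ + m - 2) (m - k) *
        ((-1) ^ l * Ring.choose (μ + k - 2) (k - l) * p l) = if l = m then p m else 0 := by
    intro l hl
    obtain ⟨d, rfl⟩ := Nat.exists_eq_add_of_le (mem_range_succ_iff.mp hl)
    rw [sum_Ico_eq_sum_range, show l + d + 1 - l = d + 1 by omega]
    have := congrArg (· * p l) (sum_twist_coeff_mul μ l d)
    simp only [sum_mul] at this
    rw [← sum_congr rfl fun j _ => ?_] at this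
    · rw [this]
      by_cases hd : d = 0 <;> simp [hd]
    · rw [show l + d - (l + j) = d - j by omega, show l + j - l = j by omega]
      ring
  rw [sum_congr rfl h]
  simp

theorem binomTwist_eq_of_odd (μ : ℂ) (p : ℕ → ℂ) (n : ℕ)
    (h : ∀ i < n, binomTwist μ p (2 * i + 1) = p (2 * i + 1))
    (m : ℕ) (hm : m ≤ 2 * n) : binomTwist μ p m = p m := by
  induction m using Nat.strong_induction_on with
  | _ m ih =>
    rcases Nat.even_or_odd' m with ⟨i, rfl | rfl⟩
    · set D := binomTwist μ p - p with hD
      have hlow : ∀ k < 2 * i, D k = 0 := fun k hk => by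
        simp [hD, ih k hk (by omega)]
      have hneg : binomTwist μ D = -D := by
        rw [hD, map_sub, binomTwist_binomTwist]
        abel
      have htop : binomTwist μ D (2 * i) = D (2 * i) := by
        rw [binomTwist_apply, sum_range_succ, sum_eq_zero fun k hk => by
          rw [hlow k (mem_range.mp hk), mul_zero]]
        simp
      rw [hneg, Pi.neg_apply, neg_eq_self] at htop
      exact sub_eq_zero.mp htop
    · exact h i (by omega)

theorem coeff_one_sub_X_pow (j k : ℕ) :
    ((1 - X : ℂ[X]) ^ j).coeff k = (-1) ^ k * Ring.choose (j : ℂ) k := by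
  have h : (1 - X : ℂ[X]) ^ j = ((1 + X) ^ j).comp (C (-1) * X) := by
    simp [sub_eq_add_neg]
  rw [h, comp_C_mul_X_coeff, coeff_one_add_X_pow, Ring.choose_natCast, mul_comm]

theorem binomTwist_coeff_comp (μ : ℂ) (Q : ℂ[X]) (N : ℕ) (hQ : Q.natDegree < N) (m : ℕ) :
    binomTwist μ (Q.comp (1 - X)).coeff m =
      ∑ j ∈ range N, Q.coeff j * Ring.choose (μ + m + j - 2) m := by
  have hc : ∀ k, (Q.comp (1 - X)).coeff k =
      ∑ j ∈ range N, Q.coeff j * ((-1) ^ k * Ring.choose (j : ℂ) k) := by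
    intro k
    rw [comp, eval₂_eq_sum_range' _ hQ, finsetSum_coeff]
    exact sum_congr rfl fun j _ => by rw [coeff_C_mul, coeff_one_sub_X_pow]
  simp only [binomTwist_apply, hc, mul_sum]
  rw [sum_comm]
  refine sum_congr rfl fun j _ => ?_
  rw [show μ + m + j - 2 = (μ + m - 2) + j by ring, choose_add_eq_sum_range, mul_sum]
  refine sum_congr rfl fun k _ => ?_
  have hk : ((-1 : ℂ) ^ k) * (-1) ^ k = 1 := by rw [← mul_pow]; simp
  linear_combination Ring.choose (μ + m - 2) (m - k) * Q.coeff j * Ring.choose (j : ℂ) k * hk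

/-- The polynomial `g₀ (1 - 2t) + ∑ i, gᵢ (t (1 - t)) ^ i`, as a linear function of `g`. -/
noncomputable def symPoly (n : ℕ) : (Fin (n + 1) → ℂ) →ₗ[ℂ] ℂ[X] :=
  Fintype.linearCombination ℂ fun i : Fin (n + 1) =>
    (X * (1 - X)) ^ (i : ℕ) + if i = 0 then 1 - 2 * X else 0

theorem symPoly_eq (n : ℕ) (g : Fin (n + 1) → ℂ) :
    symPoly n g = (∑ i : Fin (n + 1), C (g i) * X ^ (i : ℕ)).comp (X * (1 - X)) +
      C (g 0) * (1 - 2 * X) := by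
  simp [symPoly, Fintype.linearCombination_apply, smul_add, sum_add_distrib, smul_eq_C_mul,
    Polynomial.sum_comp]

theorem exists_symPoly_binomTwist (μ : ℂ) (n : ℕ) : ∃ g : Fin (n + 1) → ℂ, g ≠ 0 ∧
    ∀ i < n, binomTwist μ (symPoly n g).coeff (2 * i + 1) = (symPoly n g).coeff (2 * i + 1) := by
  let coeffs : ℂ[X] →ₗ[ℂ] (ℕ → ℂ) := LinearMap.pi (lcoeff ℂ)
  let odd : (ℕ → ℂ) →ₗ[ℂ] (Fin n → ℂ) := LinearMap.funLeft ℂ ℂ fun i : Fin n => 2 * (i : ℕ) + 1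
  let φ := odd ∘ₗ (binomTwist μ - LinearMap.id) ∘ₗ coeffs ∘ₗ symPoly n
  have hφ : LinearMap.ker φ ≠ ⊥ := LinearMap.ker_ne_bot_of_finrank_lt (by simp)
  obtain ⟨g, hg, hg0⟩ := (Submodule.ne_bot_iff _).mp hφ
  refine ⟨g, hg0, fun i hi => sub_eq_zero.mp ?_⟩
  exact congrFun (LinearMap.mem_ker.mp hg) ⟨i, hi⟩

theorem exists_reflected_poly (μ : ℂ) (n : ℕ) (hn : 1 ≤ n) : ∃ (a : ℂ) (Q : ℂ[X]), Q ≠ 0 ∧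
    Q.natDegree ≤ 2 * n ∧ Q.coeff 0 = 0 ∧ Q.comp (1 - X) = Q + C (2 * a) * (1 - 2 * X) ∧
    ∀ m ≤ 2 * n, binomTwist μ (Q.comp (1 - X)).coeff m = (Q.comp (1 - X)).coeff m := by
  obtain ⟨g, hg0, hg⟩ := exists_symPoly_binomTwist μ n
  set G : ℂ[X] := ∑ i : Fin (n + 1), C (g i) * X ^ (i : ℕ) with hG
  have hGcoeff (i : Fin (n + 1)) : G.coeff i = g i := by
    simp [hG, coeff_X_pow, Fin.val_inj]
  have hGdeg : G.natDegree ≤ n := natDegree_sum_le_of_forall_le _ _ fun i _ =>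
    (natDegree_C_mul_X_pow_le _ _).trans (Nat.lt_succ_iff.mp i.2)
  have hs : (X * (1 - X) : ℂ[X]).natDegree = 2 := by
    rw [show (X * (1 - X) : ℂ[X]) = X - X ^ 2 by ring]
    compute_degree!
  set Q : ℂ[X] := G.comp (X * (1 - X)) - C (g 0) * (1 - 2 * X) with hQ
  have hP : Q.comp (1 - X) = symPoly n g := by
    rw [symPoly_eq, hQ, sub_comp, comp_assoc, ← hG]
    simp
    ring_nf
  have hPQ : Q.comp (1 - X) = Q + C (2 * g 0) * (1 - 2 * X) := by
    rw [hP, symPoly_eq, hQ, ← hG, C_mul, C_ofNat]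
    ring
  have hQ0 : Q.coeff 0 = 0 := by
    have hG00 : G.coeff 0 = g 0 := hGcoeff 0
    rw [coeff_zero_eq_eval_zero] at hG00 ⊢
    simp [hQ, hG00]
  refine ⟨g 0, Q, ?_, ?_, hQ0, hPQ, ?_⟩
  · rintro h
    have hg00 : g 0 = 0 := by
      have := congrArg (eval 0) hPQ
      simpa [h] using this.symm
    have hG0 : G.comp (X * (1 - X)) = 0 := by
      simpa [hQ, hg00] using h
    have hGz : G = 0 := by
      rcases comp_eq_zero_iff.mp hG0 with h | h
      · exact h
      · have := congrArg natDegree h.2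
        rw [hs, natDegree_C] at this
        omega
    exact hg0 (funext fun i => by rw [← hGcoeff, hGz]; simp)
  · refine (natDegree_sub_le_of_le (m := 2 * n) (n := 1) ?_ ?_).trans ?_
    · exact natDegree_comp_le.trans (by rw [hs]; omega)
    · compute_degree
    · omega
  · rw [hP]
    exact binomTwist_eq_of_odd μ _ n hg

theorem det_mul_eq_of_vecMul_eq {m : ℕ} (M : Matrix (Fin (m + 1)) (Fin (m + 1)) ℂ)
    (w : Fin (m + 1) → ℂ) (c : ℂ) (h : Matrix.vecMul w M = Pi.single 0 c) :
    w 0 * M.det = c * (M.submatrix Fin.succ Fin.succ).det := by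
  have h1 := congrFun (congrArg (fun v => Matrix.vecMul v M.adjugate) h) 0
  simp only [Matrix.vecMul_vecMul, Matrix.mul_adjugate] at h1
  rw [Matrix.single_vecMul, Pi.smul_apply, Matrix.row_apply,
    Matrix.adjugate_fin_succ_eq_det_submatrix] at h1
  simpa [Matrix.vecMul_smul, mul_comm, Fin.succAbove_zero] using h1

theorem det_eq_zero_of_vecMul_eq_zero {m : ℕ} (M : Matrix (Fin (m + 1)) (Fin (m + 1)) ℂ)
    (w : Fin (m + 1) → ℂ) (hw : w ≠ 0) (hw0 : w 0 = 0) (h : Matrix.vecMul w M = 0) :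
    M.det = 0 ∧ (M.submatrix Fin.succ Fin.succ).det = 0 := by
  refine ⟨Matrix.exists_vecMul_eq_zero_iff.mp ⟨w, hw, h⟩,
    Matrix.exists_vecMul_eq_zero_iff.mp ⟨fun i => w i.succ, fun hz => hw ?_, ?_⟩⟩
  · funext i
    refine Fin.cases hw0 (fun i => congrFun hz i) i
  · funext j
    have := congrFun h j.succ
    simpa [Matrix.vecMul, dotProduct, Fin.sum_univ_succ, hw0] using this

/-- The constant quotient `b_{2n}(1,1,μ)/b_{2n-1}(2,2,μ) = -4/(μ+3)` (cleared form). -/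
theorem constant_quotient (μ : ℂ) (n : ℕ) (hn : 1 ≤ n) :
    (μ + 3) * bdet μ (2 * n) 1 1 = -4 * bdet μ (2 * n - 1) 2 2 := by
  obtain ⟨a, Q, hQ, hdeg, hQ0, hPQ, htw⟩ := exists_reflected_poly μ n hn
  have hPc (k : ℕ) : (Q.comp (1 - X)).coeff k =
      Q.coeff k + (if k = 0 then 2 * a else if k = 1 then -4 * a else 0) := by
    rw [hPQ, coeff_add, coeff_C_mul]
    rcases k with _ | _ | k
    · simp
    · simp [coeff_one, ← C_ofNat]; ring
    · simp [coeff_one, ← C_ofNat]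
  have hQ1 : Q.coeff 1 = a * (μ + 3) := by
    have h1 := htw 1 (by omega)
    simp [binomTwist_apply, sum_range_succ, hPc, hQ0] at h1
    linear_combination (-1 / 2) * h1
  obtain ⟨m, hm⟩ : ∃ m, 2 * n = m + 1 := ⟨2 * n - 1, by omega⟩
  rw [hm] at hdeg htw ⊢
  rw [Nat.add_sub_cancel]
  unfold bdet
  set M : Matrix (Fin (m + 1)) (Fin (m + 1)) ℂ := Matrix.of fun i j =>
    (if 1 + i.1 = 1 + j.1 then (-1 : ℂ) else 0)
      + gbinom (μ + ((1 + i.1 : ℕ) : ℂ) + ((1 + j.1 : ℕ) : ℂ) - 2) (1 + j.1) with hM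
  have hsub : (Matrix.of fun i j : Fin m => (if 2 + i.1 = 2 + j.1 then (-1 : ℂ) else 0)
      + gbinom (μ + ((2 + i.1 : ℕ) : ℂ) + ((2 + j.1 : ℕ) : ℂ) - 2) (2 + j.1)) =
      M.submatrix Fin.succ Fin.succ := by
    ext i j
    simp only [hM, Matrix.of_apply, Matrix.submatrix_apply, Fin.val_succ,
      show ∀ x : ℕ, 1 + (x + 1) = 2 + x by omega]
  rw [hsub]
  let w : Fin (m + 1) → ℂ := fun i => Q.coeff (i + 1)
  have hw : Matrix.vecMul w M = Pi.single 0 (-4 * a) := by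
    funext j
    have h1 := htw (j + 1) (by omega)
    rw [binomTwist_coeff_comp μ Q (m + 2) (by omega), sum_range_succ', hQ0, zero_mul, add_zero,
      hPc, sum_range] at h1
    have h2 : Matrix.vecMul w M j = ∑ i : Fin (m + 1), Q.coeff (i + 1) *
        Ring.choose (μ + (j + 1 : ℕ) + (i + 1 : ℕ) - 2) (j + 1) - Q.coeff (j + 1) := by
      have hterm (i : Fin (m + 1)) : w i * M i j = Q.coeff (i + 1) *
          Ring.choose (μ + (j + 1 : ℕ) + (i + 1 : ℕ) - 2) (j + 1) -
            if i = j then Q.coeff (i + 1) else 0 := by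
        rw [hM, Matrix.of_apply, gbinom_eq_choose, add_comm 1 i.1, add_comm 1 j.1,
          add_right_comm μ]
        by_cases hij : i = j
        · subst hij
          simp only [w, if_true]
          ring
        · have hne : ¬ (i.1 + 1 = j.1 + 1) := fun h => hij (Fin.ext (by omega))
          simp only [w, hij, hne, if_false]
          ring
      simp only [Matrix.vecMul, dotProduct, hterm, sum_sub_distrib]
      simp
    rw [h2, h1]
    rw [add_sub_cancel_left, if_neg (Nat.succ_ne_zero _)]
    refine Fin.cases ?_ (fun i => ?_) j
    · simp
    · simp
  by_cases ha : a = 0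
  · have := det_eq_zero_of_vecMul_eq_zero M w ?_ (by simp [w, hQ1, ha]) (by simp [hw, ha])
    · rw [this.1, this.2]; simp
    · intro hz
      apply hQ
      ext k
      rcases k with _ | k
      · simpa using hQ0
      · by_cases hk : k < m + 1
        · exact congrFun hz ⟨k, hk⟩
        · exact coeff_eq_zero_of_natDegree_lt (by omega)
  · have := det_mul_eq_of_vecMul_eq M w _ hw
    refine mul_left_cancel₀ ha ?_
    simp only [w, Fin.val_zero, zero_add, hQ1] at this
    linear_combination this
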